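/- Let φ : ℝ × ℝ^N → ℝ^N be a complete flow on ℝ^N (each φ_t := φ(t,·) a homeomorphism, φ_0 = id, φ_{s+t} = φ_s ∘ φ_t). Suppose K ⊂ ℝ^N is a nonempty compact set invariant under the flow (φ_t(K) = K for all t ∈ ℝ) with Lebesgue measure zero, and that there exists a nonempty bounded open set W ⊆ ℝ^N (not necessarily containing K) such that dist(φ_t(x), K) → 0 as t → +∞ for every x ∈ W. Then there is no measure of class 𝒜 on ℝ^N that is invariant under the flow. -/

import Mathlib

open MeasureTheory Metric Filter

/-- A measure preserved by a sequence of continuous maps gives a measurable set no more mass than any closed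
thickening of a set attracting it. -/
theorem measure_le_cthickening_of_attracted {X : Type*} [PseudoMetricSpace X] [MeasurableSpace X]
    [BorelSpace X] {μ : Measure X} {f : ℕ → X → X} (hf : ∀ n, Continuous (f n))
    (hμ : ∀ n A, MeasurableSet A → μ (f n '' A) = μ A) {K W : Set X} (hK : K.Nonempty)
    (hW : MeasurableSet W)
    (hattr : ∀ x ∈ W, Tendsto (fun n => infDist (f n x) K) atTop (nhds 0))
    {δ : ℝ} (hδ : 0 < δ) : μ W ≤ μ (cthickening δ K) := by
  let V : ℕ → Set X := fun n => W ∩ ⋂ m ≥ n, f m ⁻¹' cthickening δ K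
  have hVmeas (n) : MeasurableSet (V n) :=
    hW.inter (isClosed_iInter fun m => isClosed_iInter fun _ =>
      isClosed_cthickening.preimage (hf m)).measurableSet
  have hVmono : Monotone V := fun a b hab x hx =>
    ⟨hx.1, Set.mem_iInter₂.2 fun m hm => Set.mem_iInter₂.1 hx.2 m (hab.trans hm)⟩
  have hWV : W ⊆ ⋃ n, V n := fun x hx => by
    obtain ⟨n, hn⟩ := eventually_atTop.1 ((hattr x hx).eventually (gt_mem_nhds hδ))
    refine Set.mem_iUnion.2 ⟨n, hx, Set.mem_iInter₂.2 fun m hm => ?_⟩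
    exact thickening_subset_cthickening _ _ ((mem_thickening_iff_infDist_lt hK).2 (hn m hm))
  refine (measure_mono hWV).trans ?_
  rw [hVmono.measure_iUnion]
  refine iSup_le fun n => ?_
  rw [← hμ n _ (hVmeas n)]
  refine measure_mono ?_
  rintro _ ⟨x, hx, rfl⟩
  exact Set.mem_iInter₂.1 hx.2 n le_rfl

/-- A set attracted by a compact null set under a sequence of continuous measure-preserving maps
is null. -/
theorem measure_eq_zero_of_attracted {X : Type*} [PseudoMetricSpace X] [ProperSpace X]
    [MeasurableSpace X] [BorelSpace X] {μ : Measure X} [IsLocallyFiniteMeasure μ]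
    {f : ℕ → X → X} (hf : ∀ n, Continuous (f n))
    (hμ : ∀ n A, MeasurableSet A → μ (f n '' A) = μ A) {K W : Set X} (hK : K.Nonempty)
    (hKcpt : IsCompact K) (hKnull : μ (closure K) = 0) (hW : MeasurableSet W)
    (hattr : ∀ x ∈ W, Tendsto (fun n => infDist (f n x) K) atTop (nhds 0)) : μ W = 0 := by
  have hlim : Tendsto (fun δ => μ (cthickening δ K)) (nhdsWithin 0 (Set.Ioi 0)) (nhds 0) := by
    rw [← hKnull]
    exact (tendsto_measure_cthickening
      ⟨1, one_pos, hKcpt.isBounded.cthickening.measure_lt_top.ne⟩).mono_left nhdsWithin_le_nhds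
  refine le_antisymm (ge_of_tendsto hlim ?_) zero_le
  filter_upwards [self_mem_nhdsWithin] with δ hδ
  exact measure_le_cthickening_of_attracted hf hμ hK hW hattr hδ

/-- The measure with a locally integrable nonnegative real density is locally finite. -/
theorem isLocallyFiniteMeasure_withDensity_ofReal_of_locallyIntegrable {X : Type*}
    [TopologicalSpace X] [MeasurableSpace X] [OpensMeasurableSpace X] {μ : Measure X} {M : X → ℝ}
    (hM : LocallyIntegrable M μ) :
    IsLocallyFiniteMeasure (μ.withDensity fun x => ENNReal.ofReal (M x)) := by
  refine ⟨fun x => ?_⟩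
  obtain ⟨s, hs, hMs⟩ := hM x
  obtain ⟨U, hUs, hU, hxU⟩ := mem_nhds_iff.1 hs
  refine ⟨U, hU.mem_nhds hxU, ?_⟩
  rw [withDensity_apply _ hU.measurableSet]
  exact (hMs.mono_set hUs).lintegral_lt_top

/-- Remark 1 (partial attractors): if a nonempty compact invariant set `K` of Lebesgue
measure zero attracts some nonempty bounded open set `W` (not necessarily containing `K`),
then the flow admits no invariant measure of class 𝒜. -/
theorem no_classA_invariant_measure_of_partial_attractor
    (N : ℕ) (φ : ℝ → EuclideanSpace ℝ (Fin N) → EuclideanSpace ℝ (Fin N))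
    (hφcont : ∀ t, Continuous (φ t))
    (hφ0 : ∀ x, φ 0 x = x)
    (hφadd : ∀ s t x, φ (s + t) x = φ s (φ t x))
    (K : Set (EuclideanSpace ℝ (Fin N)))
    (hKne : K.Nonempty) (hKcpt : IsCompact K)
    (hKinv : ∀ t, φ t '' K = K)
    (hKnull : volume K = 0)
    (W : Set (EuclideanSpace ℝ (Fin N)))
    (hWne : W.Nonempty) (hWopen : IsOpen W) (hWbdd : Bornology.IsBounded W)
    (hattr : ∀ x ∈ W, Tendsto (fun t => infDist (φ t x) K) atTop (nhds 0)) :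
    ¬ ∃ M : EuclideanSpace ℝ (Fin N) → ℝ,
        Measurable M ∧ LocallyIntegrable M volume ∧ (∀ x, 0 ≤ M x) ∧
        (∀ᵐ x ∂volume, 0 < M x) ∧
        (∀ (t : ℝ) (A : Set (EuclideanSpace ℝ (Fin N))), MeasurableSet A →
          (volume.withDensity fun x => ENNReal.ofReal (M x)) (φ t '' A) =
            (volume.withDensity fun x => ENNReal.ofReal (M x)) A) := by
  rintro ⟨M, hMmeas, hMint, -, hMpos, hinv⟩
  set μ := volume.withDensity fun x => ENNReal.ofReal (M x)
  have : IsLocallyFiniteMeasure μ :=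
    isLocallyFiniteMeasure_withDensity_ofReal_of_locallyIntegrable hMint
  have hμK : μ (closure K) = 0 := by
    rw [hKcpt.isClosed.closure_eq]
    exact withDensity_absolutelyContinuous _ _ hKnull
  have hμW : μ W = 0 :=
    measure_eq_zero_of_attracted (f := fun n : ℕ => φ n) (fun n => hφcont n) (fun n => hinv n)
      hKne hKcpt hμK hWopen.measurableSet
      fun x hx => (hattr x hx).comp tendsto_natCast_atTop_atTop
  have hac : volume ≪ μ :=
    withDensity_absolutelyContinuous' hMmeas.ennreal_ofReal.aemeasurable
      (hMpos.mono fun x hx => (ENNReal.ofReal_pos.2 hx).ne')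
  exact (hWopen.measure_pos volume hWne).ne' (hac hμW)
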